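/- For every integer N ≥ 3, the low-temperature ratchet current J_R(N) := (det B_{N−1} − 2·det B_{N−2} − 2) / (2·det C_N) satisfies J_R(N) = [ ((5+3√5)/10)·((3+√5)/2)^{N−1} + ((5−3√5)/10)·((3−√5)/2)^{N−1} − ((5+3√5)/5)·((3+√5)/2)^{N−2} − ((5−3√5)/5)·((3−√5)/2)^{N−2} − 2 ] / [ 2·((3+√5)/2)^N + 2·((3−√5)/2)^N − 4 ]. -/

import Mathlib

open Matrix Real Filter

def Bmat (N : ℕ) : Matrix (Fin N) (Fin N) ℝ :=
  Matrix.of fun i j =>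
    if i = j then 3 else if (i : ℕ) = (j : ℕ) + 1 ∨ (j : ℕ) = (i : ℕ) + 1 then -1 else 0

def Cmat (N : ℕ) : Matrix (Fin N) (Fin N) ℝ :=
  Matrix.of fun i j =>
    if i = j then 3
    else if ((i : ℕ) : ZMod N) - ((j : ℕ) : ZMod N) = 1 ∨
        ((i : ℕ) : ZMod N) - ((j : ℕ) : ZMod N) = -1 then -1
    else 0

theorem Bmat_det_rec (n : ℕ) : (Bmat (n+2)).det = 3 * (Bmat (n+1)).det - (Bmat n).det := by
  rw [det_succ_row_zero, Fin.sum_univ_succ, Fin.sum_univ_succ, Finset.sum_eq_zero]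
  · have h1 : (Bmat (n+2)).submatrix Fin.succ (Fin.succAbove 0) = Bmat (n+1) := by
      ext i j
      simp [Bmat]
    have h2 : ((Bmat (n+2)).submatrix Fin.succ (Fin.succAbove (Fin.succ 0))).det
        = - (Bmat n).det := by
      rw [det_succ_column_zero, Fin.sum_univ_succ, Finset.sum_eq_zero]
      · have h3 : ((Bmat (n+2)).submatrix Fin.succ (Fin.succAbove (Fin.succ 0))).submatrix
            (Fin.succAbove 0) Fin.succ = Bmat n := by
          ext i j
          simp [Bmat, Fin.succ_succAbove_succ, ← Fin.succ_zero_eq_one, -Fin.succ_zero_eq_one]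
        rw [h3]
        simp [Bmat, Fin.ext_iff, Fin.succAbove]
      · intro i _
        simp [Bmat, Fin.ext_iff, Fin.succAbove]
    rw [h1, h2]
    simp [Bmat, Fin.ext_iff]
    ring
  · intro i _
    simp [Bmat, Fin.ext_iff]

theorem Bmat_det (n : ℕ) : (Bmat n).det =
    (5 + 3 * Real.sqrt 5) / 10 * ((3 + Real.sqrt 5) / 2) ^ n +
        (5 - 3 * Real.sqrt 5) / 10 * ((3 - Real.sqrt 5) / 2) ^ n := by
  have hs : Real.sqrt 5 ^ 2 = 5 := Real.sq_sqrt (by norm_num)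
  induction n using Nat.twoStepInduction with
  | zero => simp; ring
  | one => simp [Bmat]; linear_combination (-3/10) * hs
  | more n h1 h2 =>
    rw [Bmat_det_rec, h1, h2]
    set s := Real.sqrt 5
    have ha : ((3 + s)/2)^2 = 3 * ((3+s)/2) - 1 := by linear_combination hs/4
    have hb : ((3 - s)/2)^2 = 3 * ((3-s)/2) - 1 := by linear_combination hs/4
    rw [pow_add _ n 2, pow_add _ n 2, ha, hb]
    ring

def Pmat (n : ℕ) : Matrix (Fin (n+1)) (Fin (n+1)) ℝ :=
  Matrix.of fun i j => if j = i + 1 then 1 else 0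

theorem Pmat_mul (n : ℕ) : Pmat n * (Pmat n)ᵀ = 1 := by
  ext i j
  simp [Pmat, Matrix.mul_apply, Matrix.one_apply, eq_comm]

theorem Pmat_entry (n : ℕ) (b : ℝ) (i j : Fin (n+1)) : (1 - b • Pmat n) i j =
    (if (i:ℕ) = j then 1 else 0) -
      b * (if (j:ℕ) = (if (i:ℕ) = n then 0 else (i:ℕ) + 1) then 1 else 0) := by
  simp only [Pmat, Matrix.sub_apply, Matrix.smul_apply, of_apply, Matrix.one_apply, smul_eq_mul,
    Fin.ext_iff, Fin.val_add_one, Fin.val_last]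

theorem Pmat_det (n : ℕ) (b : ℝ) : (1 - b • Pmat (n+1)).det = 1 - b^(n+2) := by
  rw [det_succ_column_zero, Fin.sum_univ_succ, Fin.sum_univ_castSucc, Finset.sum_eq_zero]
  · have h1 : ((1 - b • Pmat (n+1)).submatrix (Fin.succAbove 0) Fin.succ).det = 1 := by
      rw [det_of_isUpperTriangular]
      · apply Finset.prod_eq_one
        intro i _
        rw [submatrix_apply, Pmat_entry, Fin.succAbove_zero, Fin.val_succ]
        grind
      · intro i j hij
        have : (j:ℕ) < i := hij
        rw [submatrix_apply, Pmat_entry, Fin.succAbove_zero, Fin.val_succ, Fin.val_succ]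
        grind
    have h2 : ((1 - b • Pmat (n+1)).submatrix (Fin.succAbove (Fin.last n).succ) Fin.succ).det
        = (-b)^(n+1) := by
      rw [det_of_isLowerTriangular]
      · rw [Finset.prod_eq_pow_card (b := -b)]
        · simp
        · intro i _
          have := i.2
          rw [submatrix_apply, Pmat_entry, Fin.succ_last, Fin.succAbove_last, Fin.val_succ,
            Fin.val_castSucc]
          grind
      · intro i j hij
        have : (i:ℕ) < j := hij
        have := j.2
        rw [submatrix_apply, Pmat_entry, Fin.succ_last, Fin.succAbove_last, Fin.val_succ,
            Fin.val_castSucc]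
        grind
    rw [h1, h2, Pmat_entry, Pmat_entry]
    simp
    rw [neg_pow b]
    have : ((-1:ℝ)^(n+1))*((-1:ℝ)^(n+1)) = 1 := by rw [← mul_pow]; simp
    linear_combination (-b*b^(n+1)) * this
  · intro i _
    have := i.2
    rw [Pmat_entry, Fin.val_succ, Fin.val_castSucc, Fin.val_zero, if_neg (show ¬ ((i:ℕ) + 1 = n + 1) by omega),
      if_neg (show ¬ ((i:ℕ) + 1 = 0) by omega), if_neg (show ¬ (0 = (i:ℕ) + 1 + 1) by omega)]
    simp

theorem Cmat_eq (n : ℕ) : Cmat (n+3) = (3:ℝ) • 1 - Pmat (n+2) - (Pmat (n+2))ᵀ := by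
  ext i j
  have hi : (((i:ℕ) : ZMod (n+3))) = (i : Fin (n+3)) := Fin.cast_val_eq_self i
  have hj : (((j:ℕ) : ZMod (n+3))) = (j : Fin (n+3)) := Fin.cast_val_eq_self j
  have e1 : (((i:ℕ) : ZMod (n+3)) - ((j:ℕ) : ZMod (n+3)) = 1) ↔ i = j + 1 := by
    rw [sub_eq_iff_eq_add', hi, hj]; rfl
  have e2 : (((i:ℕ) : ZMod (n+3)) - ((j:ℕ) : ZMod (n+3)) = -1) ↔ j = i + 1 := by
    rw [sub_eq_iff_eq_add, neg_add_eq_sub, eq_sub_iff_add_eq, eq_comm, hi, hj]; rfl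
  simp only [Cmat, of_apply, e1, e2]
  simp only [Pmat, Matrix.sub_apply, Matrix.smul_apply, transpose_apply, of_apply, Matrix.one_apply, smul_eq_mul,
    Fin.ext_iff, Fin.val_add_one, Fin.val_last]
  have := i.2
  have := j.2
  split_ifs <;> first | (exfalso; omega) | norm_num

theorem Cmat_det (n : ℕ) (a b : ℝ) (hab : a * b = 1) (h3 : a + b = 3) :
    (Cmat (n+3)).det = a^(n+3) + b^(n+3) - 2 := by
  have h : Cmat (n+3) = a • ((1 - b • Pmat (n+2)) * (1 - b • Pmat (n+2))ᵀ) := by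
    rw [Cmat_eq, transpose_sub, transpose_smul, transpose_one, sub_mul, mul_sub, mul_sub,
      Matrix.smul_mul, Matrix.smul_mul, Matrix.mul_smul, Matrix.mul_smul, Pmat_mul]
    simp only [one_mul, mul_one, smul_sub, smul_smul, hab, Matrix.smul_mul, Matrix.mul_one, ← h3,
      add_smul, ← mul_assoc, one_smul]
    abel
  rw [h, det_smul, det_mul, det_transpose, Pmat_det]
  simp only [Fintype.card_fin]
  have hp : a^(n+3) * b^(n+3) = 1 := by rw [← mul_pow, hab, one_pow]
  linear_combination (b^(n+3) - 2) * hp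

theorem stmt13 (N : ℕ) (hN : 3 ≤ N) :
    ((Bmat (N - 1)).det - 2 * (Bmat (N - 2)).det - 2) / (2 * (Cmat N).det) =
      ((5 + 3 * Real.sqrt 5) / 10 * ((3 + Real.sqrt 5) / 2) ^ (N - 1) +
        (5 - 3 * Real.sqrt 5) / 10 * ((3 - Real.sqrt 5) / 2) ^ (N - 1) -
        (5 + 3 * Real.sqrt 5) / 5 * ((3 + Real.sqrt 5) / 2) ^ (N - 2) -
        (5 - 3 * Real.sqrt 5) / 5 * ((3 - Real.sqrt 5) / 2) ^ (N - 2) - 2) /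
      (2 * ((3 + Real.sqrt 5) / 2) ^ N + 2 * ((3 - Real.sqrt 5) / 2) ^ N - 4) := by
  obtain ⟨n, rfl⟩ := Nat.exists_eq_add_of_le' hN
  have hs : Real.sqrt 5 ^ 2 = 5 := Real.sq_sqrt (by norm_num)
  rw [Bmat_det, Bmat_det, Cmat_det n ((3 + Real.sqrt 5) / 2) ((3 - Real.sqrt 5) / 2)
    (by linear_combination -hs/4) (by ring)]
  congr 1 <;> ring
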